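/- The 12×12 total 0-1 matrix M₁₂ with rows (1,1,0,0,0,0,0,0,0,1,0,0), (1,0,1,0,0,0,0,0,0,0,1,0), (0,1,1,0,0,0,0,0,0,0,0,1), (0,0,0,1,1,0,0,0,0,1,0,0), (0,0,0,1,0,1,0,0,0,0,1,0), (0,0,0,0,1,1,0,0,0,0,0,1), (0,0,0,0,0,0,1,1,0,1,0,0), (0,0,0,0,0,0,1,0,1,0,1,0), (0,0,0,0,0,0,0,1,1,0,0,1), (1,1,1,1,1,1,0,0,0,1,1,1), (0,0,0,1,1,1,1,1,1,1,1,1), (1,1,1,0,0,0,1,1,1,1,1,1) satisfies rank₊(M₁₂) = 9 and rank₀₁(M₁₂) = 12. In particular, there exists a total 0-1 matrix whose nonnegative rank is 9 and whose binary rank is 12. -/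

import Mathlib

/-- `M` is a total 0-1 matrix: every entry is `0` or `1`. -/
def Is01 {α β : Type*} (M : Matrix α β ℝ) : Prop :=
  ∀ i j, M i j = 0 ∨ M i j = 1

/-- `M` is a sum of `r` entrywise-nonnegative rank-at-most-1 real matrices,
the `k`-th summand being the outer product of the nonnegative vectors `u k` and `v k`. -/
def NNDecomp {α β : Type*} (M : Matrix α β ℝ) (r : ℕ) : Prop :=
  ∃ (u : Fin r → α → ℝ) (v : Fin r → β → ℝ),
    (∀ k i, 0 ≤ u k i) ∧ (∀ k j, 0 ≤ v k j) ∧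
    ∀ i j, M i j = ∑ k, u k i * v k j

/-- The nonnegative rank `rank₊(M)`: the smallest `r` such that `M` is a sum of `r`
entrywise-nonnegative rank-at-most-1 real matrices. -/
noncomputable def nnRank {α β : Type*} (M : Matrix α β ℝ) : ℕ :=
  sInf {r | NNDecomp M r}

/-- `M` is a sum of `r` rank-at-most-1 matrices all of whose entries are in `{0,1}`,
the `k`-th summand being the outer product of the 0-1 vectors `u k` and `v k`. -/
def BinDecomp {α β : Type*} (M : Matrix α β ℝ) (r : ℕ) : Prop :=
  ∃ (u : Fin r → α → ℝ) (v : Fin r → β → ℝ),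
    (∀ k i, u k i = 0 ∨ u k i = 1) ∧ (∀ k j, v k j = 0 ∨ v k j = 1) ∧
    ∀ i j, M i j = ∑ k, u k i * v k j

/-- The binary rank `rank₀₁(M)`: the smallest `r` such that `M` is a sum of `r`
rank-at-most-1 matrices with entries in `{0,1}`. -/
noncomputable def binRank {α β : Type*} (M : Matrix α β ℝ) : ℕ :=
  sInf {r | BinDecomp M r}

/-- The 12×12 matrix from Theorem 2(3). -/
def M12 : Matrix (Fin 12) (Fin 12) ℝ :=
  !![1,1,0,0,0,0,0,0,0,1,0,0;
     1,0,1,0,0,0,0,0,0,0,1,0;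
     0,1,1,0,0,0,0,0,0,0,0,1;
     0,0,0,1,1,0,0,0,0,1,0,0;
     0,0,0,1,0,1,0,0,0,0,1,0;
     0,0,0,0,1,1,0,0,0,0,0,1;
     0,0,0,0,0,0,1,1,0,1,0,0;
     0,0,0,0,0,0,1,0,1,0,1,0;
     0,0,0,0,0,0,0,1,1,0,0,1;
     1,1,1,1,1,1,0,0,0,1,1,1;
     0,0,0,1,1,1,1,1,1,1,1,1;
     1,1,1,0,0,0,1,1,1,1,1,1]

/-! ### The block structure of `M12` -/

/-- The row of block `g` that vanishes on the column `q` of that block. -/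
def blockRow (g q : Fin 3) : Fin 12 := ⟨3 * g + (2 - q), by omega⟩

/-- The column `c` of block `g`. -/
def blockCol (g c : Fin 3) : Fin 12 := ⟨3 * g + c, by omega⟩

/-- The last-three column whose only nonzero entry in the rows of block `g` is in `blockRow g q`. -/
def sharedCol (q : Fin 3) : Fin 12 := ⟨9 + (2 - q), by omega⟩

/-- The last-three row that vanishes on block `h`. -/
def sharedRow (h : Fin 3) : Fin 12 := ⟨9 + (h + 1) % 3, by omega⟩

lemma is01_M12 : Is01 M12 := by
  intro i j
  fin_cases i <;> fin_cases j <;> simp [M12]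

lemma M12_blockRow_blockCol (g q g' c : Fin 3) :
    M12 (blockRow g q) (blockCol g' c) = 1 ↔ g = g' ∧ q ≠ c := by
  fin_cases g <;> fin_cases q <;> fin_cases g' <;> fin_cases c <;>
    simp [M12, blockRow, blockCol]

lemma M12_blockRow_sharedCol (g q q' : Fin 3) :
    M12 (blockRow g q) (sharedCol q') = 1 ↔ q = q' := by
  fin_cases g <;> fin_cases q <;> fin_cases q' <;> simp [M12, blockRow, sharedCol]

lemma M12_sharedRow_blockCol (h g c : Fin 3) :
    M12 (sharedRow h) (blockCol g c) = 1 ↔ h ≠ g := by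
  fin_cases h <;> fin_cases g <;> fin_cases c <;> simp [M12, sharedRow, blockCol]

/-! ### Nonnegative rank -/

/-- Each of the last three rows is half the sum of the rows of the two blocks it meets. -/
lemma M12_sharedRow (h : Fin 3) (j : Fin 12) :
    M12 (sharedRow h) j =
      ∑ k : Fin 9, (if (k : ℕ) / 3 = h then 0 else 1 / 2) * M12 (k.castLE (by norm_num)) j := by
  fin_cases h <;> fin_cases j <;> norm_num [M12, Fin.sum_univ_succ, sharedRow]

lemma nnDecomp_M12 : NNDecomp M12 9 := by
  refine ⟨fun k i => if i.val < 9 then (if k.val = i.val then 1 else 0)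
      else if (k : ℕ) / 3 = (i.val + 2) % 3 then 0 else 1 / 2,
    fun k j => M12 (k.castLE (by norm_num)) j, ?_, ?_, ?_⟩
  · intro k i
    dsimp only
    split_ifs <;> norm_num
  · intro k j
    rcases is01_M12 (k.castLE (by norm_num)) j with h | h <;> simp [h]
  · intro i j
    by_cases hi : i.val < 9
    · rw [Finset.sum_eq_single ⟨i, hi⟩]
      · simp [hi]
      · intro k _ hk
        have : k.val ≠ i.val := fun h => hk (Fin.ext h)
        simp [hi, this]
      · simp
    · have hr : i = sharedRow ⟨(i.val + 2) % 3, Nat.mod_lt _ (by norm_num)⟩ := by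
        ext
        simp only [sharedRow]
        omega
      simp only [hi, if_false]
      conv_lhs => rw [hr]
      exact M12_sharedRow _ j

lemma NNDecomp.rank_le {m n : Type*} [Fintype m] [Fintype n] {M : Matrix m n ℝ} {r : ℕ}
    (h : NNDecomp M r) : M.rank ≤ r := by
  obtain ⟨u, v, -, -, h⟩ := h
  have hM : M = (Matrix.of fun i k => u k i) * Matrix.of v := by
    ext i j
    simp [Matrix.mul_apply, h]
  calc M.rank ≤ (Matrix.of fun i k => u k i).rank := hM ▸ Matrix.rank_mul_le_left _ _
    _ ≤ Fintype.card (Fin r) := Matrix.rank_le_card_width _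
    _ = r := Fintype.card_fin r

lemma nine_le_rank_M12 : 9 ≤ M12.rank := by
  have hli : LinearIndependent ℝ fun k : Fin 9 => M12 (k.castLE (by norm_num)) := by
    rw [Fintype.linearIndependent_iff]
    intro w hw
    have h : ∀ j, ∑ k : Fin 9, w k * M12 (k.castLE (by norm_num)) j = 0 := fun j => by
      simpa using congrFun hw j
    have h0 := h 0
    have h1 := h 1
    have h2 := h 2
    have h3 := h 3
    have h4 := h 4
    have h5 := h 5
    have h6 := h 6
    have h7 := h 7
    have h8 := h 8
    simp [M12, Fin.sum_univ_succ] at h0 h1 h2 h3 h4 h5 h6 h7 h8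
    intro k
    fin_cases k <;> simp <;> linarith
  have hspan := finrank_span_eq_card hli
  rw [Matrix.rank_eq_finrank_span_row]
  rw [Fintype.card_fin] at hspan
  rw [← hspan]
  apply Submodule.finrank_mono
  apply Submodule.span_mono
  rintro _ ⟨k, rfl⟩
  exact ⟨_, rfl⟩

/-! ### Binary rank -/

/-- `F` colours the `1`-entries of `M` so that every colour class is a rectangle. -/
def IsRectColoring {α β ι : Type*} (M : Matrix α β ℝ) (F : α → β → ι) : Prop :=
  ∀ i j i' j', M i j = 1 → M i' j' = 1 → F i j = F i' j' → M i j' = 1 ∧ F i j' = F i j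

lemma BinDecomp.exists_isRectColoring {α β : Type*} {M : Matrix α β ℝ} {r : ℕ} (hM : Is01 M)
    (h : BinDecomp M r) {i₀ : α} {j₀ : β} (h₀ : M i₀ j₀ = 1) :
    ∃ F : α → β → Fin r, IsRectColoring M F := by
  obtain ⟨u, v, hu, hv, h⟩ := h
  have hnn : ∀ k i j, 0 ≤ u k i * v k j := fun k i j => by
    rcases hu k i with h | h <;> rcases hv k j with h' | h' <;> simp [h, h']
  have hex : ∀ i j, M i j = 1 → ∃ k, u k i = 1 ∧ v k j = 1 := by
    intro i j hij
    by_contra! hne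
    have : M i j = 0 := by
      rw [h]
      refine Finset.sum_eq_zero fun k _ => ?_
      rcases hu k i with hk | hk
      · simp [hk]
      · simp [(hv k j).resolve_right (hne k hk)]
    linarith
  have hone : ∀ k i j, u k i = 1 → v k j = 1 → M i j = 1 := by
    intro k i j hk hk'
    refine (hM i j).resolve_left fun h0 => ?_
    have := Finset.single_le_sum (fun k _ => hnn k i j) (Finset.mem_univ k)
    rw [← h, hk, hk', h0] at this
    linarith
  have huniq : ∀ k l i j, u k i = 1 → v k j = 1 → u l i = 1 → v l j = 1 → k = l := by
    intro k l i j h1 h2 h3 h4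
    by_contra hkl
    have hle := Finset.sum_le_sum_of_subset_of_nonneg (Finset.subset_univ {k, l})
      (fun k _ _ => hnn k i j)
    rw [← h, Finset.sum_pair hkl, h1, h2, h3, h4, hone k i j h1 h2] at hle
    linarith
  obtain ⟨k₀, -⟩ := hex i₀ j₀ h₀
  have hF : ∀ i j, ∃ k, M i j = 1 → u k i = 1 ∧ v k j = 1 := fun i j => by
    by_cases hij : M i j = 1
    · obtain ⟨k, hk⟩ := hex i j hij
      exact ⟨k, fun _ => hk⟩
    · exact ⟨k₀, fun h => absurd h hij⟩
  choose F hF using hF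
  refine ⟨F, fun i j i' j' hij hij' heq => ?_⟩
  have hu1 := (hF i j hij).1
  have hv1 := (hF i' j' hij').2
  rw [← heq] at hv1
  have h1 := hone _ _ _ hu1 hv1
  exact ⟨h1, huniq _ _ i j' (hF i j' h1).1 (hF i j' h1).2 hu1 hv1⟩

namespace IsRectColoring

variable {ι : Type*} {F : Fin 12 → Fin 12 → ι}

open Classical in
/-- The colours that occur in the diagonal block `g`. -/
noncomputable def blockColors (F : Fin 12 → Fin 12 → ι) (g : Fin 3) : Finset ι :=
  (Finset.univ.filter fun p : Fin 3 × Fin 3 => p.1 ≠ p.2).image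
    fun p => F (blockRow g p.1) (blockCol g p.2)

lemma mem_blockColors {g : Fin 3} {x : ι} :
    x ∈ blockColors F g ↔ ∃ q c, q ≠ c ∧ F (blockRow g q) (blockCol g c) = x := by
  simp [blockColors]

lemma disjoint_blockColors (hF : IsRectColoring M12 F) {g g' : Fin 3} (hg : g ≠ g') :
    Disjoint (blockColors F g) (blockColors F g') := by
  rw [Finset.disjoint_left]
  intro x hx hx'
  obtain ⟨q, c, hqc, rfl⟩ := mem_blockColors.1 hx
  obtain ⟨q', c', hqc', h⟩ := mem_blockColors.1 hx'
  have := (hF _ _ _ _ ((M12_blockRow_blockCol _ _ _ _).2 ⟨rfl, hqc⟩)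
    ((M12_blockRow_blockCol _ _ _ _).2 ⟨rfl, hqc'⟩) h.symm).1
  exact hg ((M12_blockRow_blockCol _ _ _ _).1 this).1

/-- Equal colours within a block lie in a common row or a common column. -/
lemma ne_of_block_eq (hF : IsRectColoring M12 F) {g q c q' c' : Fin 3} (hqc : q ≠ c)
    (hqc' : q' ≠ c')
    (h : F (blockRow g q) (blockCol g c) = F (blockRow g q') (blockCol g c')) : q ≠ c' :=
  ((M12_blockRow_blockCol _ _ _ _).1 (hF _ _ _ _ ((M12_blockRow_blockCol _ _ _ _).2 ⟨rfl, hqc⟩)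
    ((M12_blockRow_blockCol _ _ _ _).2 ⟨rfl, hqc'⟩) h).1).2

/-- A diagonal block uses at least three colours; if it uses exactly three, then they are
constant along its rows or constant along its columns. -/
lemma card_blockColors (hF : IsRectColoring M12 F) (g : Fin 3) :
    3 ≤ (blockColors F g).card ∧ (4 ≤ (blockColors F g).card ∨
      (∀ q c c', q ≠ c → q ≠ c' →
        F (blockRow g q) (blockCol g c) = F (blockRow g q) (blockCol g c')) ∨
      (∀ c q q', q ≠ c → q' ≠ c →
        F (blockRow g q) (blockCol g c) = F (blockRow g q') (blockCol g c))) := by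
  classical
  have key : ∀ q c q' c' : Fin 3, q ≠ c → q' ≠ c' → q = c' ∨ q' = c →
      F (blockRow g q) (blockCol g c) ≠ F (blockRow g q') (blockCol g c') := by
    rintro q c q' c' h1 h2 (h | h) heq
    · exact hF.ne_of_block_eq h1 h2 heq h
    · exact hF.ne_of_block_eq h2 h1 heq.symm h
  have hmem : ∀ q c : Fin 3, q ≠ c → F (blockRow g q) (blockCol g c) ∈ blockColors F g :=
    fun q c h => mem_blockColors.2 ⟨q, c, h, rfl⟩
  set a : Fin 3 → Fin 3 → ι := fun q c => F (blockRow g q) (blockCol g c)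
  set s : Finset ι := {a 0 1, a 1 2, a 2 0} with hs
  have hcard : s.card = 3 := by
    rw [hs, Finset.card_eq_three]
    exact ⟨_, _, _, key 0 1 1 2 (by decide) (by decide) (by decide),
      key 0 1 2 0 (by decide) (by decide) (by decide),
      key 1 2 2 0 (by decide) (by decide) (by decide), rfl⟩
  have hsub : s ⊆ blockColors F g := by
    intro x hx
    simp only [hs, Finset.mem_insert, Finset.mem_singleton] at hx
    rcases hx with rfl | rfl | rfl <;> exact hmem _ _ (by decide)
  refine ⟨hcard ▸ Finset.card_le_card hsub, ?_⟩
  rw [or_iff_not_imp_left]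
  intro hlt
  have heq : s = blockColors F g := Finset.eq_of_subset_of_card_le hsub (by omega)
  have h02 : a 0 2 ∈ s := heq ▸ hmem 0 2 (by decide)
  have h10 : a 1 0 ∈ s := heq ▸ hmem 1 0 (by decide)
  have h21 : a 2 1 ∈ s := heq ▸ hmem 2 1 (by decide)
  have n1 : a 0 2 ≠ a 2 0 := key 0 2 2 0 (by decide) (by decide) (by decide)
  have n2 : a 1 0 ≠ a 0 1 := key 1 0 0 1 (by decide) (by decide) (by decide)
  have n3 : a 2 1 ≠ a 1 2 := key 2 1 1 2 (by decide) (by decide) (by decide)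
  have n4 : a 0 2 ≠ a 1 0 := key 0 2 1 0 (by decide) (by decide) (by decide)
  have n5 : a 1 0 ≠ a 2 1 := key 1 0 2 1 (by decide) (by decide) (by decide)
  have n6 : a 2 1 ≠ a 0 2 := key 2 1 0 2 (by decide) (by decide) (by decide)
  simp only [hs, Finset.mem_insert, Finset.mem_singleton] at h02 h10 h21
  have hrc : (a 0 1 = a 0 2 ∧ a 1 0 = a 1 2 ∧ a 2 0 = a 2 1) ∨
      (a 1 0 = a 2 0 ∧ a 0 1 = a 2 1 ∧ a 0 2 = a 1 2) := by grind
  rcases hrc with ⟨e0, e1, e2⟩ | ⟨e0, e1, e2⟩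
  · left
    intro q c c' h h'
    change a q c = a q c'
    fin_cases q <;> fin_cases c <;> fin_cases c' <;>
      first
        | rfl | exact absurd rfl h | exact absurd rfl h' | exact e0 | exact e0.symm
        | exact e1 | exact e1.symm | exact e2 | exact e2.symm
  · right
    intro c q q' h h'
    change a q c = a q' c
    fin_cases c <;> fin_cases q <;> fin_cases q' <;>
      first
        | rfl | exact absurd rfl h | exact absurd rfl h' | exact e0 | exact e0.symm
        | exact e1 | exact e1.symm | exact e2 | exact e2.symm

/-- If a block is coloured along its columns, then its entries in the last three columns carry
colours that occur in no block. -/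
lemma sharedCol_notMem_blockColors (hF : IsRectColoring M12 F) {g : Fin 3}
    (hcol : ∀ c q q', q ≠ c → q' ≠ c →
      F (blockRow g q) (blockCol g c) = F (blockRow g q') (blockCol g c)) (q g' : Fin 3) :
    F (blockRow g q) (sharedCol q) ∉ blockColors F g' := by
  intro hmem
  obtain ⟨q', c, hqc, h⟩ := mem_blockColors.1 hmem
  have hb := (M12_blockRow_sharedCol g q q).2 rfl
  have hgq := hF _ _ _ _ hb ((M12_blockRow_blockCol _ _ _ _).2 ⟨rfl, hqc⟩) h.symm
  obtain ⟨rfl, -⟩ := (M12_blockRow_blockCol _ _ _ _).1 hgq.1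
  obtain ⟨p, hpq, hpc⟩ : ∃ p : Fin 3, p ≠ q ∧ p ≠ c := by
    clear * -
    revert q c
    decide
  rw [hcol c q' p hqc hpc] at h
  exact hpq ((M12_blockRow_sharedCol _ _ _).1
    (hF _ _ _ _ ((M12_blockRow_blockCol _ _ _ _).2 ⟨rfl, hpc⟩) hb h).1)

/-- If a block is coloured along its rows, then each of the last three rows that is nonzero on
this block has there an entry whose colour occurs in no block. -/
lemma exists_sharedRow_notMem_blockColors (hF : IsRectColoring M12 F) {g h : Fin 3} (hgh : h ≠ g)
    (hrow : ∀ q c c', q ≠ c → q ≠ c' →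
      F (blockRow g q) (blockCol g c) = F (blockRow g q) (blockCol g c')) :
    ∃ c, ∀ g', F (sharedRow h) (blockCol g c) ∉ blockColors F g' := by
  by_contra! hcon
  have hd : ∀ c, M12 (sharedRow h) (blockCol g c) = 1 :=
    fun c => (M12_sharedRow_blockCol _ _ _).2 hgh
  have ha : ∀ q c, q ≠ c → M12 (blockRow g q) (blockCol g c) = 1 :=
    fun q c hqc => (M12_blockRow_blockCol _ _ _ _).2 ⟨rfl, hqc⟩
  have step : ∀ c, ∃ q, q ≠ c ∧ ∀ c', q ≠ c' →
      F (sharedRow h) (blockCol g c') = F (blockRow g q) (blockCol g c') := by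
    intro c
    obtain ⟨g', hg'⟩ := hcon c
    obtain ⟨q, c₁, hqc, heq⟩ := mem_blockColors.1 hg'
    obtain ⟨h1, h2⟩ := hF _ _ _ _ ((M12_blockRow_blockCol _ _ _ _).2 ⟨rfl, hqc⟩) (hd c) heq
    obtain ⟨rfl, hqc'⟩ := (M12_blockRow_blockCol _ _ _ _).1 h1
    refine ⟨q, hqc', fun c' hc' => ?_⟩
    have e := hrow q c₁ c' hqc hc'
    rw [← e, heq]
    exact (hF _ _ _ _ (hd c) (ha q c' hc') (heq.symm.trans e)).2
  obtain ⟨q, hq, hqF⟩ := step 0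
  obtain ⟨p, hp, hpF⟩ := step q
  obtain ⟨c, hcq, hcp⟩ : ∃ c : Fin 3, q ≠ c ∧ p ≠ c := by
    clear * -
    revert q p
    decide
  have e := (hqF c hcq).symm.trans (hpF c hcp)
  rw [hrow q c p hcq hp.symm] at e
  exact hF.ne_of_block_eq hcp hp.symm e.symm rfl

/-- A colouring of `M12` with rectangular classes needs at least twelve colours. -/
lemma twelve_le_card [Fintype ι] (hF : IsRectColoring M12 F) : 12 ≤ Fintype.card ι := by
  classical
  have hdisj : ((Finset.univ : Finset (Fin 3)) : Set (Fin 3)).PairwiseDisjoint (blockColors F) :=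
    fun g _ g' _ hg => hF.disjoint_blockColors hg
  by_cases hcol : ∃ g, ∀ c q q', q ≠ c → q' ≠ c →
      F (blockRow g q) (blockCol g c) = F (blockRow g q') (blockCol g c)
  · obtain ⟨g, hg⟩ := hcol
    set t : Finset ι := Finset.univ.image fun q => F (blockRow g q) (sharedCol q) with ht
    have ht3 : t.card = 3 := by
      rw [ht, Finset.card_image_of_injective, Finset.card_fin]
      intro q q' h
      exact (M12_blockRow_sharedCol _ _ _).1 (hF _ _ _ _ ((M12_blockRow_sharedCol g q q).2 rfl)
        ((M12_blockRow_sharedCol g q' q').2 rfl) h).1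
    have htd : Disjoint t (Finset.univ.biUnion (blockColors F)) := by
      rw [Finset.disjoint_left]
      intro x hx hx'
      obtain ⟨q, -, rfl⟩ := Finset.mem_image.1 hx
      obtain ⟨g', -, hg'⟩ := Finset.mem_biUnion.1 hx'
      exact hF.sharedCol_notMem_blockColors hg q g' hg'
    calc 12 = 3 + ∑ _g : Fin 3, 3 := by simp
      _ ≤ t.card + ∑ g, (blockColors F g).card :=
        add_le_add ht3.ge (Finset.sum_le_sum fun g _ => (hF.card_blockColors g).1)
      _ = (t ∪ Finset.univ.biUnion (blockColors F)).card := by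
        rw [Finset.card_union_of_disjoint htd, Finset.card_biUnion hdisj]
      _ ≤ Fintype.card ι := Finset.card_le_univ _
  · have hx : ∀ g, ∃ s : Finset ι, 4 ≤ (blockColors F g ∪ s).card ∧ ∀ x ∈ s,
        (∀ g', x ∉ blockColors F g') ∧ ∃ c, F (sharedRow (g + 1)) (blockCol g c) = x := by
      intro g
      obtain ⟨h3, h4 | hrow | hc⟩ := hF.card_blockColors g
      · exact ⟨∅, by simpa using h4, by simp⟩
      · obtain ⟨c, hc⟩ := hF.exists_sharedRow_notMem_blockColors
          (show g + 1 ≠ g by clear * -; revert g; decide) hrow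
        refine ⟨{F (sharedRow (g + 1)) (blockCol g c)}, ?_, ?_⟩
        · rw [Finset.card_union_of_disjoint (Finset.disjoint_singleton_right.2 (hc g)),
            Finset.card_singleton]
          omega
        · simpa using hc
      · exact absurd ⟨g, hc⟩ hcol
    choose s hs4 hs using hx
    have hss : ∀ g, ∀ x ∈ s g, x ∉ s (g + 1) := by
      intro g x hx hx'
      obtain ⟨-, c, hc⟩ := hs g x hx
      obtain ⟨-, c', hc'⟩ := hs (g + 1) x hx'
      have hne : ∀ g : Fin 3, g + 1 ≠ g := by decide
      exact (M12_sharedRow_blockCol _ _ _).1 (hF _ _ _ _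
        ((M12_sharedRow_blockCol _ _ _).2 (hne g))
        ((M12_sharedRow_blockCol _ _ _).2 (hne (g + 1))) (hc.trans hc'.symm)).1 rfl
    have hsd : ∀ g g', g ≠ g' → Disjoint (s g) (s g') := by
      intro g g' hg
      rw [Finset.disjoint_left]
      intro x hx hx'
      obtain rfl | rfl : g' = g + 1 ∨ g = g' + 1 := by
        clear * - hg
        revert g g'
        decide
      · exact hss _ _ hx hx'
      · exact hss _ _ hx' hx
    have hud : ((Finset.univ : Finset (Fin 3)) : Set (Fin 3)).PairwiseDisjoint
        fun g => blockColors F g ∪ s g := by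
      intro g _ g' _ hg
      simp only [Function.onFun, Finset.disjoint_union_left, Finset.disjoint_union_right]
      exact ⟨⟨hF.disjoint_blockColors hg,
        Finset.disjoint_left.2 fun x hx => (hs g x hx).1 g'⟩,
        Finset.disjoint_right.2 fun x hx => (hs g' x hx).1 g, hsd g g' hg⟩
    calc 12 = ∑ _g : Fin 3, 4 := by simp
      _ ≤ ∑ g, (blockColors F g ∪ s g).card := Finset.sum_le_sum fun g _ => hs4 g
      _ = (Finset.univ.biUnion fun g => blockColors F g ∪ s g).card :=
        (Finset.card_biUnion hud).symm
      _ ≤ Fintype.card ι := Finset.card_le_univ _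

end IsRectColoring

lemma Is01.binDecomp {n : ℕ} {β : Type*} {M : Matrix (Fin n) β ℝ} (hM : Is01 M) :
    BinDecomp M n := by
  refine ⟨fun k i => if k = i then 1 else 0, M, fun k i => ?_, hM, fun i j => ?_⟩
  · by_cases h : k = i <;> simp [h]
  · simp

/-- The matrix `M12` satisfies `rank₊(M12) = 9` and `rank₀₁(M12) = 12`;
in particular there is a total 0-1 matrix with nonnegative rank 9 and binary rank 12. -/
theorem rank_nine_twelve : nnRank M12 = 9 ∧ binRank M12 = 12 := by
  constructor
  · exact le_antisymm (Nat.sInf_le nnDecomp_M12)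
      (le_csInf ⟨9, nnDecomp_M12⟩ fun r hr => nine_le_rank_M12.trans (NNDecomp.rank_le hr))
  · refine le_antisymm (Nat.sInf_le is01_M12.binDecomp)
      (le_csInf ⟨12, is01_M12.binDecomp⟩ fun r hr => ?_)
    obtain ⟨F, hF⟩ := BinDecomp.exists_isRectColoring is01_M12 hr (i₀ := 0) (j₀ := 0)
      (by simp [M12])
    simpa using hF.twelve_le_card
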